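/- Let S and A be finite types. Let μ, μ' be probability distributions on S, for each s ∈ S let π(·|s), π'(·|s) be probability distributions on A, with joints p(s,a) = μ(s)·π(a|s) and p'(s,a) = μ'(s)·π'(a|s). Let P(·|s',a), P'(·|s',a) be probability distributions on S for each (s',a), and let ν(s) = ∑_{(s',a)} P(s|s',a)·p(s',a) and ν'(s) = ∑_{(s',a)} P'(s|s',a)·p'(s',a) be the resulting state marginals. Then D_TV(ν, ν') ≤ D_TV(μ, μ') + ∑_{s} μ(s)·D_TV(π(·|s), π'(·|s)) + ∑_{(s',a)} p'(s',a)·D_TV(P(·|s',a), P'(·|s',a)). -/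

import Mathlib

open Finset

/-- Total variation distance between two (probability) distributions on a finite type. -/
noncomputable def tvDist {X : Type*} [Fintype X] (p q : X → ℝ) : ℝ :=
  (1 / 2) * ∑ x, |p x - q x|

/-- Pushing two weights through two stochastic kernels. -/
lemma tvDist_kernel_le {X Y : Type*} [Fintype X] [Fintype Y]
    (p p' : X → ℝ) (K K' : X → Y → ℝ) (hp' : ∀ x, 0 ≤ p' x)
    (hK0 : ∀ x y, 0 ≤ K x y) (hK1 : ∀ x, ∑ y, K x y = 1) :
    tvDist (fun y => ∑ x, K x y * p x) (fun y => ∑ x, K' x y * p' x)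
      ≤ tvDist p p' + ∑ x, p' x * tvDist (K x) (K' x) := by
  have pointwise (y : Y) : |∑ x, K x y * p x - ∑ x, K' x y * p' x|
      ≤ ∑ x, (K x y * |p x - p' x| + p' x * |K x y - K' x y|) := by
    rw [← Finset.sum_sub_distrib]
    refine (Finset.abs_sum_le_sum_abs _ _).trans (Finset.sum_le_sum fun x _ => ?_)
    calc |K x y * p x - K' x y * p' x|
        = |K x y * (p x - p' x) + p' x * (K x y - K' x y)| := by ring_nf
      _ ≤ |K x y * (p x - p' x)| + |p' x * (K x y - K' x y)| := abs_add_le _ _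
      _ = _ := by rw [abs_mul, abs_mul, abs_of_nonneg (hK0 x y), abs_of_nonneg (hp' x)]
  have total := Finset.sum_le_sum fun y (_ : y ∈ Finset.univ) => pointwise y
  rw [Finset.sum_comm] at total
  simp only [Finset.sum_add_distrib, ← Finset.sum_mul, ← Finset.mul_sum, hK1, one_mul] at total
  simp only [tvDist, mul_left_comm _ (1 / 2 : ℝ), ← Finset.mul_sum]
  linarith

/-- The distance of two joint weights is at most the distance of the marginals plus the expected
distance of the conditionals. -/
lemma tvDist_joint_le {X Y : Type*} [Fintype X] [Fintype Y]
    (p p' : X → ℝ) (K K' : X → Y → ℝ) (hp : ∀ x, 0 ≤ p x)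
    (hK'0 : ∀ x y, 0 ≤ K' x y) (hK'1 : ∀ x, ∑ y, K' x y = 1) :
    tvDist (fun z : X × Y => p z.1 * K z.1 z.2) (fun z => p' z.1 * K' z.1 z.2)
      ≤ tvDist p p' + ∑ x, p x * tvDist (K x) (K' x) := by
  have pointwise (x : X) (y : Y) : |p x * K x y - p' x * K' x y|
      ≤ K' x y * |p x - p' x| + p x * |K x y - K' x y| := by
    calc |p x * K x y - p' x * K' x y|
        = |K' x y * (p x - p' x) + p x * (K x y - K' x y)| := by ring_nf
      _ ≤ |K' x y * (p x - p' x)| + |p x * (K x y - K' x y)| := abs_add_le _ _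
      _ = _ := by rw [abs_mul, abs_mul, abs_of_nonneg (hK'0 x y), abs_of_nonneg (hp x)]
  have total := Finset.sum_le_sum fun x (_ : x ∈ Finset.univ) =>
    Finset.sum_le_sum fun y (_ : y ∈ Finset.univ) => pointwise x y
  simp only [Finset.sum_add_distrib, ← Finset.sum_mul, ← Finset.mul_sum, hK'1, one_mul] at total
  simp only [tvDist, Fintype.sum_prod_type, mul_left_comm _ (1 / 2 : ℝ), ← Finset.mul_sum]
  linarith

/-- combined one-step recursion in the proof of Theorem 1. -/
theorem tv_one_step_recursion {S A : Type*} [Fintype S] [Fintype A]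
    (μ μ' : S → ℝ) (π π' : S → A → ℝ) (P P' : S × A → S → ℝ)
    (hμ0 : ∀ s, 0 ≤ μ s) (hμ1 : ∑ s, μ s = 1)
    (hμ'0 : ∀ s, 0 ≤ μ' s) (hμ'1 : ∑ s, μ' s = 1)
    (hπ0 : ∀ s a, 0 ≤ π s a) (hπ1 : ∀ s, ∑ a, π s a = 1)
    (hπ'0 : ∀ s a, 0 ≤ π' s a) (hπ'1 : ∀ s, ∑ a, π' s a = 1)
    (hP0 : ∀ x s, 0 ≤ P x s) (hP1 : ∀ x, ∑ s, P x s = 1)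
    (hP'0 : ∀ x s, 0 ≤ P' x s) (hP'1 : ∀ x, ∑ s, P' x s = 1) :
    tvDist (fun s => ∑ x : S × A, P x s * (μ x.1 * π x.1 x.2))
        (fun s => ∑ x : S × A, P' x s * (μ' x.1 * π' x.1 x.2))
      ≤ tvDist μ μ' + (∑ s, μ s * tvDist (π s) (π' s))
        + ∑ x : S × A, (μ' x.1 * π' x.1 x.2) * tvDist (P x) (P' x) := by
  exact (tvDist_kernel_le _ _ P P' (fun x => mul_nonneg (hμ'0 x.1) (hπ'0 x.1 x.2)) hP0 hP1).trans
    (add_le_add_left (tvDist_joint_le μ μ' π π' hμ0 hπ'0 hπ'1) _)
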